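/- For every (θ, θ⋆) ∈ ℒ* and every integer 0 ≤ j ≤ 4, the point (ζ^j θ, ζ^{2j} θ⋆) is an element of (1/25)ℒ. -/

import Mathlib

open Complex MeasureTheory Real

noncomputable section

/-- ζ = exp(2πi/5), a primitive fifth root of unity. -/
def ζ₅ : ℂ := Complex.exp (2 * Real.pi * Complex.I / 5)

/-- Integer combination a + b z + c z² + d z³. -/
def comb (a b c d : ℤ) (z : ℂ) : ℂ := a + b * z + c * z ^ 2 + d * z ^ 3

/-- The lattice ℒ = σ((1−ζ)ℤ[ζ]) ⊆ ℂ × ℂ ≅ ℝ⁴, where σ = (σ₁, σ₂) is the Minkowski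
embedding, σ₁(ζ) = ζ and σ₂(ζ) = ζ². -/
def PenLat : Set (ℂ × ℂ) :=
  { p | ∃ a b c d : ℤ,
      p = ((1 - ζ₅) * comb a b c d ζ₅, (1 - ζ₅ ^ 2) * comb a b c d (ζ₅ ^ 2)) }

/-- The standard real inner product on ℂ ≅ ℝ². -/
def rdot (z w : ℂ) : ℝ := z.re * w.re + z.im * w.im

/-- The dual lattice ℒ* with respect to the standard inner product on ℝ⁴ = ℂ × ℂ. -/
def dualLat : Set (ℂ × ℂ) :=
  { ξ | ∀ ℓ ∈ PenLat, ∃ k : ℤ, rdot ξ.1 ℓ.1 + rdot ξ.2 ℓ.2 = (k : ℝ) }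

/-- τ = (1+√5)/2, the golden ratio. -/
def τ₀ : ℝ := (1 + Real.sqrt 5) / 2

/-- P, the convex hull of the fifth roots of unity. -/
def Pent : Set ℂ := convexHull ℝ {1, ζ₅, ζ₅ ^ 2, ζ₅ ^ 3, ζ₅ ^ 4}

/-- The windows W_{m,ω} for m = 1, 2, 3, 4. -/
def Window (m : ℕ) (ω : ℂ) : Set ℂ :=
  match m with
  | 1 => (fun z => z - 1 + ω) '' Pent
  | 2 => (fun z => -(τ₀ : ℂ) * z - 2 + ω) '' Pent
  | 3 => (fun z => (τ₀ : ℂ) * z - 3 + ω) '' Pent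
  | 4 => (fun z => -z - 4 + ω) '' Pent
  | _ => ∅

/-- The Fourier transform of the indicator function of a set A ⊆ ℂ ≅ ℝ². -/
def ftInd (A : Set ℂ) (y : ℂ) : ℂ :=
  ∫ x in A, Complex.exp (-(2 * Real.pi * Complex.I) * (rdot x y))

/-- Multiplication by a primitive fifth root of unity in the basis `1, z, z², z³`. -/
lemma mul_comb {z : ℂ} (hz : 1 + z + z ^ 2 + z ^ 3 + z ^ 4 = 0) (a b c d : ℤ) :
    z * comb a b c d z = comb (-d) (a - d) (b - d) (c - d) z := by
  simp only [comb]
  push_cast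
  linear_combination (d : ℂ) * hz

lemma zeta_pow_five : ζ₅ ^ 5 = 1 := by
  rw [ζ₅, ← Complex.exp_nat_mul, ← Complex.exp_two_pi_mul_I]
  congr 1
  push_cast
  ring

lemma zeta_sum : 1 + ζ₅ + ζ₅ ^ 2 + ζ₅ ^ 3 + ζ₅ ^ 4 = 0 := by
  have hprim : IsPrimitiveRoot ζ₅ 5 := by
    simpa [ζ₅] using Complex.isPrimitiveRoot_exp 5 (by norm_num)
  simpa [Finset.sum_range_succ] using hprim.geom_sum_eq_zero (by norm_num)

lemma zeta_sq_sum :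
    1 + ζ₅ ^ 2 + (ζ₅ ^ 2) ^ 2 + (ζ₅ ^ 2) ^ 3 + (ζ₅ ^ 2) ^ 4 = 0 := by
  linear_combination zeta_sum + (ζ₅ + ζ₅ ^ 3) * zeta_pow_five

lemma conj_zeta : (starRingEnd ℂ) ζ₅ = ζ₅ ^ 4 := by
  have hnorm : ‖ζ₅‖ = 1 := Complex.norm_eq_one_of_pow_eq_one zeta_pow_five (by norm_num)
  rw [← Complex.inv_eq_conj hnorm]
  refine inv_eq_of_mul_eq_one_right ?_
  linear_combination zeta_pow_five

lemma two_mul_rdot (z w : ℂ) :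
    2 * (rdot z w : ℂ) = z * (starRingEnd ℂ) w + (starRingEnd ℂ) z * w := by
  apply Complex.ext <;> simp [rdot] <;> ring

/-- `PenLat` is stable under multiplication by `ζ`. -/
lemma PenLat.zeta_pow_smul_mem {p : ℂ × ℂ} (hp : p ∈ PenLat) (j : ℕ) :
    (ζ₅ ^ j * p.1, ζ₅ ^ (2 * j) * p.2) ∈ PenLat := by
  induction j with
  | zero => simpa using hp
  | succ j ih =>
    obtain ⟨a, b, c, d, h⟩ := ih
    obtain ⟨h₁, h₂⟩ := Prod.ext_iff.mp h
    simp only at h₁ h₂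
    refine ⟨-d, a - d, b - d, c - d, Prod.ext ?_ ?_⟩
    · simp only [← mul_comb zeta_sum]
      linear_combination ζ₅ * h₁
    · simp only [← mul_comb zeta_sq_sum]
      linear_combination ζ₅ ^ 2 * h₂

/-- Fourier inversion over the fifth roots of unity: the first coordinate of a dual vector is
recovered from its pairings `k i` with the lattice basis `(1 - z) * z ^ i`. -/
lemma eq_comb_of_pairings {z x xbar y ybar : ℂ} (hz : 1 + z + z ^ 2 + z ^ 3 + z ^ 4 = 0)
    (k : Fin 4 → ℤ)
    (h : ∀ i : Fin 4, x * ((1 - z ^ 4) * z ^ (4 * (i : ℕ))) + xbar * ((1 - z) * z ^ (i : ℕ)) +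
      (y * ((1 - z ^ 3) * z ^ (3 * (i : ℕ))) + ybar * ((1 - z ^ 2) * z ^ (2 * (i : ℕ)))) =
        2 * k i) :
    25 * x = (1 - z) * comb (2 * (4 * k 0 + 3 * k 1 + 2 * k 2 + k 3))
      (2 * (3 * k 0 + 6 * k 1 + 4 * k 2 + 2 * k 3))
      (2 * (2 * k 0 + 4 * k 1 + 6 * k 2 + 3 * k 3)) (2 * (k 0 + 2 * k 1 + 3 * k 2 + 4 * k 3)) z := by
  have h0 := h 0
  have h1 := h 1
  have h2 := h 2
  have h3 := h 3
  simp only [Fin.val_zero, Fin.val_one, Fin.val_two, show ((3 : Fin 4) : ℕ) = 3 from rfl]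
    at h0 h1 h2 h3
  have inversion : 5 * (x * (1 - z ^ 4)) = 2 * (k 0 * (1 - z ^ 4) + k 1 * (z - z ^ 4) +
      k 2 * (z ^ 2 - z ^ 4) + k 3 * (z ^ 3 - z ^ 4)) := by
    linear_combination (1 - z ^ 4) * h0 + (z - z ^ 4) * h1 + (z ^ 2 - z ^ 4) * h2 +
      (z ^ 3 - z ^ 4) * h3 +
      (x * (4 - 4 * z - 3 * z ^ 4 + 6 * z ^ 5 - 3 * z ^ 6 - 2 * z ^ 9 + 4 * z ^ 10 -
          2 * z ^ 11 - z ^ 14 + 2 * z ^ 15 - z ^ 16) +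
        xbar * (-1 + 2 * z - 2 * z ^ 2 + 2 * z ^ 3 - z ^ 4) +
        y * (-1 + z + z ^ 3 - z ^ 4 - z ^ 5 + z ^ 6 + z ^ 7 - z ^ 8 - z ^ 10 +
          2 * z ^ 11 - z ^ 12) +
        ybar * (-1 + z + z ^ 2 - 2 * z ^ 3 + 2 * z ^ 4 - z ^ 5 - z ^ 6 + 2 * z ^ 7 - z ^ 8)) * hz
  simp only [comb]
  push_cast
  linear_combination (1 - z) * (1 - z ^ 2) * (1 - z ^ 3) * inversion +
      (x * (20 - 15 * z - 5 * z ^ 3 + 10 * z ^ 5 - 5 * z ^ 6) +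
        k 0 * (-6 + 6 * z + 2 * z ^ 3 - 4 * z ^ 5 + 2 * z ^ 6) +
        k 1 * (-6 + 2 * z + 6 * z ^ 2 - 4 * z ^ 5 + 2 * z ^ 6) +
        k 2 * (-4 + 2 * z ^ 2 + 6 * z ^ 3 - 2 * z ^ 4 - 4 * z ^ 5 + 2 * z ^ 6) +
        k 3 * (-2 + 2 * z ^ 3 + 4 * z ^ 4 - 6 * z ^ 5 + 2 * z ^ 6)) * hz

/-- **Lemma.** For every (θ, θ⋆) ∈ ℒ* and every 0 ≤ j ≤ 4, the point (ζ^j θ, ζ^{2j} θ⋆)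
lies in (1/25)ℒ, i.e. 25·(ζ^j θ, ζ^{2j} θ⋆) ∈ ℒ. -/
theorem dualLat_rotate_mem_inv25_lat :
    ∀ p : ℂ × ℂ, p ∈ dualLat → ∀ j : ℕ, j ≤ 4 →
      ((25 : ℂ) * (ζ₅ ^ j * p.1), (25 : ℂ) * (ζ₅ ^ (2 * j) * p.2)) ∈ PenLat := by
  intro p hp j _
  let a : Fin 4 → Fin 4 → ℤ := fun i l => if l = i then 1 else 0
  have hcomb (i : Fin 4) (z : ℂ) : comb (a i 0) (a i 1) (a i 2) (a i 3) z = z ^ (i : ℕ) := by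
    fin_cases i <;> simp [a, comb]
  choose k hk using fun i : Fin 4 => hp _ ⟨a i 0, a i 1, a i 2, a i 3, rfl⟩
  simp only [hcomb] at hk
  have pairing (i : Fin 4) := congrArg (fun t : ℝ => 2 * (t : ℂ)) (hk i)
  simp only [ofReal_add, mul_add, two_mul_rdot, map_mul, map_sub, map_one, map_pow, conj_zeta,
    ofReal_intCast] at pairing
  have mem : ((25 : ℂ) * p.1, (25 : ℂ) * p.2) ∈ PenLat := by
    refine ⟨_, _, _, _, Prod.ext
      (eq_comb_of_pairings (xbar := (starRingEnd ℂ) p.1) (y := p.2) (ybar := (starRingEnd ℂ) p.2)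
        zeta_sum k fun i => ?_)
      (eq_comb_of_pairings (xbar := (starRingEnd ℂ) p.2) (y := (starRingEnd ℂ) p.1) (ybar := p.1)
        zeta_sq_sum k fun i => ?_)⟩
    · rw [← pairing i]
      fin_cases i <;> simp <;> grind [zeta_pow_five]
    · rw [← pairing i]
      fin_cases i <;> simp <;> grind [zeta_pow_five]
  simpa only [mul_left_comm] using PenLat.zeta_pow_smul_mem mem j

end
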